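/- Let M > K ≥ 1, let Ĝ be a random M×K complex matrix whose entries are mutually independent with every entry in column j distributed as CN(0, σ_j²) (σ_j² > 0), set W^T := (Ĝ^H Ĝ)^{-1} Ĝ^H and A := Ĝ^* (Ĝ^T Ĝ^*)^{-1}, and let Π be a K×K permutation matrix whose k-th row has its 1 in column π(k). Let e ∈ ℂ^{M} be a random vector independent of Ĝ whose entries are i.i.d. CN(0, σ_e²). Then E{ | ĝ_k^T A Π W^T e |² } = σ_e² / ( (M−K) · σ_{π(k)}² ), where ĝ_k denotes the k-th column of Ĝ. -/

import Mathlib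

open MeasureTheory ProbabilityTheory Matrix Filter

/-- Matrices inherit the (pi) measurable structure of functions. -/
instance matrixMeasurableSpace {m n α : Type*} [MeasurableSpace α] :
    MeasurableSpace (Matrix m n α) :=
  inferInstanceAs (MeasurableSpace (m → n → α))

/-- The circularly-symmetric complex Gaussian distribution `CN(0, v)`:
real and imaginary parts are independent real Gaussians, each of variance `v/2`. -/
noncomputable def complexGaussian (v : ℝ) : Measure ℂ :=
  Measure.map (fun p : ℝ × ℝ => ⟨p.1, p.2⟩)
    ((gaussianReal 0 (v / 2).toNNReal).prod (gaussianReal 0 (v / 2).toNNReal))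


theorem meas_mkC : Measurable (fun p : ℝ × ℝ => (⟨p.1, p.2⟩ : ℂ)) :=
  Complex.measurableEquivRealProd.symm.measurable

instance complexGaussian_prob (v : ℝ) : IsProbabilityMeasure (complexGaussian v) :=
  Measure.isProbabilityMeasure_map meas_mkC.aemeasurable

theorem charFun_complexGaussian (v : ℝ) (hv : 0 ≤ v) (t : ℂ) :
    charFun (complexGaussian v) t = Complex.exp (-((v / 4 * ‖t‖ ^ 2 : ℝ) : ℂ)) := by
  rw [charFun_apply, complexGaussian, integral_map meas_mkC.aemeasurable (by fun_prop)]
  have h : ∀ p : ℝ × ℝ, Complex.exp ((inner ℝ (⟨p.1, p.2⟩ : ℂ) t : ℝ) * Complex.I)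
      = Complex.exp (t.re * p.1 * Complex.I) * Complex.exp (t.im * p.2 * Complex.I) := by
    intro p
    rw [← Complex.exp_add]
    congr 1
    rw [Complex.inner]
    simp [Complex.mul_re]
    ring
  simp_rw [h]
  rw [integral_prod_mul (fun x : ℝ => Complex.exp (t.re * x * Complex.I))
    (fun x : ℝ => Complex.exp (t.im * x * Complex.I)), ← charFun_apply_real, ← charFun_apply_real,
    charFun_gaussianReal, charFun_gaussianReal, ← Complex.exp_add]
  congr 1
  have h2 : (((v / 2).toNNReal : ℝ) : ℂ) = v / 2 := by
    rw [Real.coe_toNNReal _ (by positivity)]; simp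
  rw [← Complex.normSq_eq_norm_sq, Complex.normSq_apply]
  push_cast
  have h3 : (((v / 2).toNNReal : NNReal) : ℂ) = v / 2 := h2
  rw [h3]
  ring

theorem integral_exp_sq_gaussianReal (s : ℝ) (hs : 0 < s) (t : ℝ) (ht : 0 ≤ t) :
    ∫ x, Real.exp (-t * x ^ 2) ∂(gaussianReal 0 s.toNNReal) = (Real.sqrt (1 + 2 * t * s))⁻¹ := by
  have hs' : s.toNNReal ≠ 0 := by simpa using hs
  rw [integral_gaussianReal_eq_integral_smul hs']
  simp only [gaussianPDFReal, smul_eq_mul, Real.coe_toNNReal _ hs.le, sub_zero]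
  have h : ∀ x : ℝ, (Real.sqrt (2 * Real.pi * s))⁻¹ * Real.exp (-x ^ 2 / (2 * s)) * Real.exp (-t * x ^ 2)
      = (Real.sqrt (2 * Real.pi * s))⁻¹ * Real.exp (-(1 / (2 * s) + t) * x ^ 2) := by
    intro x
    rw [mul_assoc, ← Real.exp_add]
    congr 2
    field_simp
    ring
  simp_rw [h]
  rw [integral_const_mul, integral_gaussian, ← Real.sqrt_inv, ← Real.sqrt_mul (by positivity),
    ← Real.sqrt_inv]
  congr 1
  have := Real.pi_pos
  field_simp

theorem integral_exp_complexGaussian (v : ℝ) (hv : 0 < v) (t : ℝ) (ht : 0 ≤ t) :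
    ∫ z, Real.exp (-t * ‖z‖ ^ 2) ∂(complexGaussian v) = (1 + t * v)⁻¹ := by
  rw [complexGaussian, integral_map meas_mkC.aemeasurable (by fun_prop)]
  have h : ∀ p : ℝ × ℝ, Real.exp (-t * ‖(⟨p.1, p.2⟩ : ℂ)‖ ^ 2)
      = Real.exp (-t * p.1 ^ 2) * Real.exp (-t * p.2 ^ 2) := by
    intro p
    rw [← Real.exp_add, ← Complex.normSq_eq_norm_sq, Complex.normSq_apply]
    congr 1
    simp only
    ring
  simp_rw [h]
  rw [integral_prod_mul (fun x : ℝ => Real.exp (-t * x ^ 2)) (fun x : ℝ => Real.exp (-t * x ^ 2)),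
    integral_exp_sq_gaussianReal _ (by positivity) _ ht, ← mul_inv, Real.mul_self_sqrt (by positivity)]
  congr 1
  ring

theorem integral_id_complexGaussian (v : ℝ) :
    ∫ z, z ∂(complexGaussian v) = 0 := by
  rw [complexGaussian, integral_map meas_mkC.aemeasurable (by fun_prop)]
  have hi : Integrable (fun x : ℝ => (x : ℂ)) (gaussianReal 0 (v / 2).toNNReal) :=
    ((memLp_id_gaussianReal 1).integrable (by simp)).ofReal
  have h : ∀ p : ℝ × ℝ, (⟨p.1, p.2⟩ : ℂ) = (p.1 : ℂ) + (p.2 : ℂ) * Complex.I := by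
    intro p; apply Complex.ext <;> simp
  simp_rw [h]
  rw [integral_add]
  · rw [integral_mul_const, integral_fun_fst (fun x : ℝ => (x : ℂ)),
      integral_fun_snd (fun x : ℝ => (x : ℂ)), integral_complex_ofReal, integral_id_gaussianReal]
    simp
  · exact hi.comp_fst _
  · exact (hi.comp_snd _).mul_const _

theorem memLp_complexGaussian (v : ℝ) : MemLp (fun z : ℂ => z) 2 (complexGaussian v) := by
  rw [complexGaussian, memLp_map_measure_iff (by fun_prop) meas_mkC.aemeasurable]
  have hi : MemLp (fun x : ℝ => (x : ℂ)) 2 (gaussianReal 0 (v / 2).toNNReal) :=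
    (memLp_id_gaussianReal 2).ofReal
  have h : (fun z : ℂ => z) ∘ (fun p : ℝ × ℝ => (⟨p.1, p.2⟩ : ℂ))
      = fun p => (p.1 : ℂ) + Complex.I * (p.2 : ℂ) := by
    funext p; apply Complex.ext <;> simp
  rw [h]
  exact (hi.comp_fst _).add ((hi.comp_snd _).const_mul _)

theorem integral_sq_gaussianReal (s : NNReal) : ∫ x, x ^ 2 ∂(gaussianReal 0 s) = s := by
  have := variance_eq_sub (memLp_id_gaussianReal (μ := 0) (v := s) 2)
  rw [variance_id_gaussianReal] at this
  simp [integral_id_gaussianReal] at this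
  exact this.symm

theorem integral_normSq_complexGaussian (v : ℝ) (hv : 0 ≤ v) :
    ∫ z, ‖z‖ ^ 2 ∂(complexGaussian v) = v := by
  rw [complexGaussian, integral_map meas_mkC.aemeasurable (by fun_prop)]
  have hi : Integrable (fun x : ℝ => x ^ 2) (gaussianReal 0 (v / 2).toNNReal) :=
    (memLp_id_gaussianReal 2).integrable_sq
  have h : ∀ p : ℝ × ℝ, ‖(⟨p.1, p.2⟩ : ℂ)‖ ^ 2 = p.1 ^ 2 + p.2 ^ 2 := by
    intro p
    rw [← Complex.normSq_eq_norm_sq, Complex.normSq_apply]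
    simp only
    ring
  simp_rw [h]
  rw [integral_add]
  · rw [integral_fun_fst (fun x : ℝ => x ^ 2),
      integral_fun_snd (fun x : ℝ => x ^ 2), integral_sq_gaussianReal, 
      Real.coe_toNNReal _ (by positivity)]
    simp
  · exact hi.comp_fst _
  · exact hi.comp_snd _

/-- The law on Euclidean space of a vector with i.i.d. complex Gaussian entries. -/
noncomputable def nuE (M : ℕ) (v : ℝ) : Measure (EuclideanSpace ℂ (Fin M)) :=
  (Measure.pi fun _ : Fin M => complexGaussian v).map (WithLp.toLp 2)

instance nuE_prob (M : ℕ) (v : ℝ) : IsProbabilityMeasure (nuE M v) :=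
  Measure.isProbabilityMeasure_map (by fun_prop)

theorem charFun_nuE (M : ℕ) (v : ℝ) (hv : 0 ≤ v) (t : EuclideanSpace ℂ (Fin M)) :
    charFun (nuE M v) t = Complex.exp (-((v / 4 * ‖t‖ ^ 2 : ℝ) : ℂ)) := by
  rw [nuE, charFun_pi]
  simp_rw [charFun_complexGaussian v hv]
  rw [← Complex.exp_sum, EuclideanSpace.norm_sq_eq, Finset.mul_sum]
  push_cast
  rw [Finset.sum_neg_distrib]

theorem nuE_map (M : ℕ) (v : ℝ) (hv : 0 ≤ v)
    (U : EuclideanSpace ℂ (Fin M) ≃ₗᵢ[ℂ] EuclideanSpace ℂ (Fin M)) :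
    (nuE M v).map U = nuE M v := by
  have hU : Measurable U := U.continuous.measurable
  have : IsProbabilityMeasure ((nuE M v).map U) := Measure.isProbabilityMeasure_map hU.aemeasurable
  apply Measure.ext_of_charFun
  funext t
  have h1 : charFun ((nuE M v).map U) t = charFun (nuE M v) (U.symm t) := by
    rw [charFun_apply, charFun_apply, integral_map hU.aemeasurable (by fun_prop)]
    congr 1
    funext x
    have : inner ℝ (U x) t = inner ℝ x (U.symm t) := by
      have := (U.toLinearEquiv.restrictScalars ℝ)
      let U' : EuclideanSpace ℂ (Fin M) ≃ₗᵢ[ℝ] EuclideanSpace ℂ (Fin M) :=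
        ⟨U.toLinearEquiv.restrictScalars ℝ, U.norm_map⟩
      have h := U'.inner_map_map x (U.symm t)
      have e1 : U' x = U x := rfl
      have e2 : U' (U.symm t) = t := U.apply_symm_apply t
      rw [← h, e1, e2]
    rw [this]
  rw [h1, charFun_nuE _ _ hv, charFun_nuE _ _ hv, LinearIsometryEquiv.norm_map]

theorem laplace_sub (M : ℕ) (v : ℝ) (hv : 0 < v)
    (T : Submodule ℂ (EuclideanSpace ℂ (Fin M))) (t : ℝ) (ht : 0 ≤ t) :
    ∫ u, Real.exp (-t * ‖T.starProjection u‖ ^ 2) ∂(nuE M v)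
      = ((1 + t * v)⁻¹) ^ (Module.finrank ℂ T) := by
  classical
  set r := Module.finrank ℂ T with hr
  have hrM : r ≤ M := by
    have := Submodule.finrank_le T
    simpa using this
  let bT := stdOrthonormalBasis ℂ T
  let w : Fin M → EuclideanSpace ℂ (Fin M) := fun i => if h : i.1 < r then (bT ⟨i.1, h⟩ : _) else 0
  let s : Set (Fin M) := {i | i.1 < r}
  have hw : Orthonormal ℂ (s.domRestrict w) := by
    have h1 : Orthonormal ℂ (fun k => (bT k : EuclideanSpace ℂ (Fin M))) :=
      bT.orthonormal.comp_linearIsometry T.subtypeₗᵢ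
    have h2 := h1.comp (fun i : s => (⟨i.1.1, i.2⟩ : Fin r))
      (by intro a b hab; apply Subtype.ext; apply Fin.ext; simpa using hab)
    convert h2 using 1
    funext i
    have : i.1.1 < r := i.2
    simp [w, this, Set.domRestrict]
  obtain ⟨b, hb⟩ := hw.exists_orthonormalBasis_extension_of_card_eq (by simp)
  have hnorm : ∀ u, ‖T.starProjection u‖ ^ 2 = ∑ i : Fin M, if i.1 < r then ‖b.repr u i‖ ^ 2 else 0 := by
    intro u
    rw [Submodule.starProjection_apply, ← Submodule.coe_norm, ← bT.sum_sq_norm_inner_right]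
    have h1 : ∀ k : Fin r, ‖inner ℂ (bT k) (T.orthogonalProjectionOnto u)‖ ^ 2
        = ‖b.repr u (Fin.castLE hrM k)‖ ^ 2 := by
      intro k
      rw [b.repr_apply_apply, hb (Fin.castLE hrM k) (by simp [s])]
      have : w (Fin.castLE hrM k) = bT k := by simp [w]
      rw [this, Submodule.inner_orthogonalProjectionOnto_eq_of_mem_left]
    rw [Finset.sum_congr rfl (fun k _ => h1 k), ← Finset.sum_filter]
    symm
    apply Finset.sum_bij' (fun i hi => (⟨i.1, by simpa using hi⟩ : Fin r)) (fun k _ => Fin.castLE hrM k)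
    all_goals simp
  simp_rw [hnorm]
  have hmap := nuE_map M v hv.le b.repr
  have hU : Measurable b.repr := b.repr.continuous.measurable
  let f : EuclideanSpace ℂ (Fin M) → ℝ := fun z =>
    Real.exp (-t * ∑ i : Fin M, if i.1 < r then ‖z i‖ ^ 2 else 0)
  have hf : Continuous f := by
    apply Real.continuous_exp.comp
    apply continuous_const.mul
    apply continuous_finsetSum
    intro i _
    split_ifs <;> fun_prop
  have : ∫ u, f (b.repr u) ∂(nuE M v) = ∫ u, f u ∂(nuE M v) := by
    conv_rhs => rw [← hmap]
    rw [integral_map hU.aemeasurable hf.aestronglyMeasurable]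
  change ∫ u, f (b.repr u) ∂(nuE M v) = _
  rw [this, nuE, integral_map (by fun_prop) hf.aestronglyMeasurable]
  let g : Fin M → ℂ → ℝ := fun i z => if i.1 < r then Real.exp (-t * ‖z‖ ^ 2) else 1
  have hfg : ∀ x : Fin M → ℂ, f (WithLp.toLp 2 x) = ∏ i, g i (x i) := by
    intro x
    simp only [f, g, Finset.mul_sum, Real.exp_sum]
    apply Finset.prod_congr rfl
    intro i _
    split_ifs <;> simp
  simp_rw [hfg]
  rw [integral_fintype_prod_eq_prod]
  have hg : ∀ i : Fin M, ∫ z, g i z ∂(complexGaussian v) = if i.1 < r then (1 + t * v)⁻¹ else 1 := by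
    intro i
    simp only [g]
    split_ifs
    · exact integral_exp_complexGaussian v hv t ht
    · simp
  simp_rw [hg]
  rw [Finset.prod_ite, Finset.prod_const, Finset.prod_const_one, mul_one]
  congr 1
  rw [Fin.card_filter_val_lt]
  exact min_eq_right hrM

theorem inv_eq_lintegral (x : ℝ) (hx : 0 ≤ x) :
    (ENNReal.ofReal x)⁻¹ = ∫⁻ t in Set.Ioi (0 : ℝ), ENNReal.ofReal (Real.exp (-t * x)) := by
  rcases hx.eq_or_lt with rfl | hx
  · simp
  · rw [← ofReal_integral_eq_lintegral_ofReal]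
    · have := integral_exp_mul_Ioi (a := -x) (by linarith) 0
      have h2 : ∀ t : ℝ, -t * x = -x * t := fun t => by ring
      simp_rw [h2]
      rw [this, ← ENNReal.ofReal_inv_of_pos hx]
      simp
    · have := integrableOn_exp_mul_Ioi (a := -x) (by linarith) 0
      have h2 : ∀ t : ℝ, -t * x = -x * t := fun t => by ring
      simp_rw [h2]
      exact this
    · exact Filter.Eventually.of_forall fun t => (Real.exp_pos _).le

theorem lintegral_pow (v : ℝ) (hv : 0 < v) (n : ℕ) (hn : 1 ≤ n) :
    ∫⁻ t in Set.Ioi (0 : ℝ), ENNReal.ofReal (((1 + t * v)⁻¹) ^ (n + 1))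
      = ENNReal.ofReal (1 / (n * v)) := by
  have hn' : (0 : ℝ) < n := by exact_mod_cast hn
  let F : ℝ → ℝ := fun t => - (1 / (n * v)) * ((1 + t * v)⁻¹) ^ n
  have hd : ∀ t ∈ Set.Ici (0 : ℝ), HasDerivAt F (((1 + t * v)⁻¹) ^ (n + 1)) t := by
    intro t ht
    have ht : 0 ≤ t := ht
    have hp : 0 < 1 + t * v := by positivity
    have h1 : HasDerivAt (fun t : ℝ => 1 + t * v) v t := by
      simpa using ((hasDerivAt_id t).mul_const v).const_add 1
    have h2 := ((h1.inv hp.ne').pow n).const_mul (-(1 / (n * v)))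
    have h3 : ((1 + t * v)⁻¹) ^ (n + 1)
        = -(1 / (n * v)) * (n * ((1 + t * v)⁻¹) ^ (n - 1) * (-v / (1 + t * v) ^ 2)) := by
      obtain ⟨m, rfl⟩ : ∃ m, n = m + 1 := ⟨n - 1, by omega⟩
      simp only [Nat.add_sub_cancel, inv_pow]
      field_simp
      ring
    rw [h3]
    exact h2
  have hlim : Tendsto F atTop (nhds 0) := by
    have h1 : Tendsto (fun t : ℝ => 1 + t * v) atTop atTop :=
      tendsto_atTop_add_const_left _ _ (tendsto_id.atTop_mul_const hv)
    have h2 := ((tendsto_inv_atTop_zero.comp h1).pow n).const_mul (-(1 / (n * v)))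
    simpa [F, show n ≠ 0 by omega] using h2
  have hpos : ∀ t ∈ Set.Ioi (0 : ℝ), 0 ≤ ((1 + t * v)⁻¹) ^ (n + 1) := by
    intro t ht
    have : 0 < t := ht
    positivity
  have hintg := integrableOn_Ioi_deriv_of_nonneg' hd hpos hlim
  have hval := integral_Ioi_of_hasDerivAt_of_nonneg' hd hpos hlim
  rw [← ofReal_integral_eq_lintegral_ofReal hintg
    ((ae_restrict_iff' measurableSet_Ioi).2 (Filter.Eventually.of_forall hpos)), hval]
  simp [F]

theorem lintegral_inv_proj (M : ℕ) (v : ℝ) (hv : 0 < v)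
    (T : Submodule ℂ (EuclideanSpace ℂ (Fin M))) (n : ℕ) (hn : 1 ≤ n)
    (hT : Module.finrank ℂ T = n + 1) :
    ∫⁻ u, (ENNReal.ofReal (‖T.starProjection u‖ ^ 2))⁻¹ ∂(nuE M v) = ENNReal.ofReal (1 / (n * v)) := by
  simp_rw [fun u => inv_eq_lintegral (‖T.starProjection u‖ ^ 2) (by positivity)]
  rw [lintegral_lintegral_swap (by fun_prop), ← lintegral_pow v hv n hn]
  apply setLIntegral_congr_fun measurableSet_Ioi
  intro t ht
  have ht : 0 < t := ht
  change ∫⁻ u, ENNReal.ofReal (Real.exp (-t * ‖T.starProjection u‖ ^ 2)) ∂(nuE M v)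
    = ENNReal.ofReal (((1 + t * v)⁻¹) ^ (n + 1))
  rw [← hT, ← laplace_sub M v hv T t ht.le, ofReal_integral_eq_lintegral_ofReal]
  · refine Integrable.of_bound (C := 1) (by fun_prop) (Filter.Eventually.of_forall fun u => ?_)
    rw [Real.norm_of_nonneg (Real.exp_pos _).le, Real.exp_le_one_iff]
    have : 0 ≤ t * ‖T.starProjection u‖ ^ 2 := by positivity
    linarith
  · exact Filter.Eventually.of_forall fun t => (Real.exp_pos _).le

theorem ae_notMem (M : ℕ) (v : ℝ) (hv : 0 < v)
    (S : Submodule ℂ (EuclideanSpace ℂ (Fin M))) (hS : Module.finrank ℂ S + 2 ≤ M) :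
    ∀ᵐ u ∂(nuE M v), u ∉ S := by
  have h1 : Module.finrank ℂ S + Module.finrank ℂ Sᗮ = M := by
    have := S.finrank_add_finrank_orthogonal
    simpa using this
  have h2 := lintegral_inv_proj M v hv Sᗮ (Module.finrank ℂ Sᗮ - 1) (by omega) (by omega)
  have h3 := ae_lt_top (μ := nuE M v)
    (f := fun u => (ENNReal.ofReal (‖Sᗮ.starProjection u‖ ^ 2))⁻¹) (by fun_prop)
    (by rw [h2]; exact ENNReal.ofReal_ne_top)
  filter_upwards [h3] with u hu hmem
  rw [Submodule.starProjection_orthogonal_val, Submodule.starProjection_eq_self_iff.2 hmem] at hu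
  simp at hu

theorem li_insertNth {V : Type*} [AddCommGroup V] [Module ℂ V] {n : ℕ} (j : Fin (n + 1)) (x : V)
    (c : Fin n → V) :
    LinearIndependent ℂ (j.insertNth x c : Fin (n + 1) → V) ↔
      LinearIndependent ℂ c ∧ x ∉ Submodule.span ℂ (Set.range c) := by
  rw [← linearIndependent_equiv (finSuccEquiv' j).symm, linearIndependent_option]
  have : ((j.insertNth x c : Fin (n + 1) → V) ∘ (finSuccEquiv' j).symm) ∘ (fun a : Fin n => (a : Option (Fin n))) = c := by
    funext i; simp
  simp only [this]
  simp

theorem finrank_span_le (M n : ℕ) (c : Fin n → EuclideanSpace ℂ (Fin M)) :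
    Module.finrank ℂ (Submodule.span ℂ (Set.range c)) ≤ n := by
  have := finrank_range_le_card (R := ℂ) c
  simpa [Set.finrank] using this

theorem ae_li (M n : ℕ) (hn : n < M) (σ : Fin n → ℝ) (hσ : ∀ j, 0 < σ j) :
    ∀ᵐ c ∂(Measure.pi fun j => nuE M (σ j)), LinearIndependent ℂ c := by
  induction n with
  | zero => exact Filter.Eventually.of_forall fun c => linearIndependent_empty_type
  | succ n ih =>
    have mp := measurePreserving_piFinSuccAbove (fun j => nuE M (σ j)) 0
    have hm : Measurable (fun p : EuclideanSpace ℂ (Fin M) × (Fin n → EuclideanSpace ℂ (Fin M)) =>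
        (Fin.insertNth (0 : Fin (n + 1)) p.1 p.2 : Fin (n + 1) → EuclideanSpace ℂ (Fin M))) :=
      (MeasurableEquiv.piFinSuccAbove (fun _ => EuclideanSpace ℂ (Fin M)) 0).symm.measurable
    have hQ : ∀ᵐ p ∂((nuE M (σ 0)).prod (Measure.pi fun j : Fin n => nuE M (σ (Fin.succAbove 0 j)))),
        LinearIndependent ℂ (Fin.insertNth (0 : Fin (n + 1)) p.1 p.2 : Fin (n + 1) → EuclideanSpace ℂ (Fin M)) := by
      have hms : MeasurableSet {p : EuclideanSpace ℂ (Fin M) × (Fin n → EuclideanSpace ℂ (Fin M)) |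
        LinearIndependent ℂ (Fin.insertNth (0 : Fin (n + 1)) p.1 p.2 : Fin (n + 1) → EuclideanSpace ℂ (Fin M))} :=
        hm (isOpen_setOfPred_linearIndependent.measurableSet)
      rw [Measure.ae_prod_iff_ae_ae hms, Measure.ae_ae_comm hms]
      filter_upwards [ih (by omega) (fun j => σ (Fin.succAbove 0 j)) (fun j => hσ _)] with c hc
      filter_upwards [ae_notMem M (σ 0) (hσ 0) (Submodule.span ℂ (Set.range c))
        (by have := finrank_span_le M n c; omega)] with x hx
      exact (li_insertNth _ _ _).2 ⟨hc, hx⟩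
    have := mp.quasiMeasurePreserving.ae hQ
    filter_upwards [this] with c hc
    convert hc using 1
    exact ((MeasurableEquiv.piFinSuccAbove (fun _ => EuclideanSpace ℂ (Fin M)) 0).symm_apply_apply c).symm

theorem gram_inv_entry (M n : ℕ) (c : Fin (n + 1) → EuclideanSpace ℂ (Fin M))
    (hc : LinearIndependent ℂ c) (j : Fin (n + 1)) :
    (Matrix.gram ℂ c)⁻¹ j j = (((‖(Submodule.span ℂ (Set.range fun k => c (j.succAbove k)))ᗮ.starProjection
      (c j)‖ ^ 2)⁻¹ : ℝ) : ℂ) := by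
  set S := Submodule.span ℂ (Set.range fun k => c (j.succAbove k)) with hS
  have hdet : IsUnit (Matrix.gram ℂ c).det :=
    (Matrix.det_gram_ne_zero_iff_linearIndependent.2 hc).isUnit
  set N := Matrix.gram ℂ c with hN
  let y : EuclideanSpace ℂ (Fin M) := ∑ b, N⁻¹ b j • c b
  have hy : ∀ a, inner ℂ (c a) y = if a = j then 1 else 0 := by
    intro a
    have h1 : inner ℂ (c a) y = (N * N⁻¹) a j := by
      simp only [y, inner_sum, inner_smul_right, Matrix.mul_apply, hN, Matrix.gram_apply]
      exact Finset.sum_congr rfl fun b _ => mul_comm _ _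
    rw [h1, Matrix.mul_nonsing_inv _ hdet, Matrix.one_apply]
  have hyS : y ∈ Sᗮ := by
    have hle : S ≤ (ℂ ∙ y)ᗮ := by
      rw [hS, Submodule.span_le]
      rintro _ ⟨k, rfl⟩
      rw [SetLike.mem_coe, Submodule.mem_orthogonal_singleton_iff_inner_left]
      rw [hy, if_neg (Fin.succAbove_ne j k)]
    rw [Submodule.mem_orthogonal]
    intro u hu
    exact Submodule.mem_orthogonal_singleton_iff_inner_left.1 (hle hu)
  have hP : y = N⁻¹ j j • Sᗮ.starProjection (c j) := by
    have h1 : Sᗮ.starProjection y = y := Submodule.starProjection_eq_self_iff.2 hyS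
    rw [← h1]
    simp only [y, map_sum, map_smul]
    rw [Finset.sum_eq_single j]
    · intro b _ hb
      obtain ⟨k, rfl⟩ := Fin.exists_succAbove_eq hb
      have : c (j.succAbove k) ∈ S := Submodule.subset_span ⟨k, rfl⟩
      rw [Submodule.starProjection_orthogonal_val, Submodule.starProjection_eq_self_iff.2 this]
      simp
    · simp
  have h1 := hy j
  rw [hP, inner_smul_right, if_pos rfl] at h1
  have h2 : inner ℂ (c j) (Sᗮ.starProjection (c j)) = ((‖Sᗮ.starProjection (c j)‖ ^ 2 : ℝ) : ℂ) := by
    have := Submodule.inner_orthogonalProjectionOnto_eq_of_mem_right (K := Sᗮ)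
      (Sᗮ.orthogonalProjectionOnto (c j)) (c j)
    rw [Submodule.starProjection_apply, ← this, ← Submodule.coe_norm, inner_self_eq_norm_sq_to_K]
    simp
  rw [h2] at h1
  rw [Complex.ofReal_inv]
  exact eq_inv_of_mul_eq_one_left h1

theorem meas_gram_inv (M n : ℕ) (i j : Fin n) :
    Measurable fun c : Fin n → EuclideanSpace ℂ (Fin M) => (Matrix.gram ℂ c)⁻¹ i j := by
  have hg : Continuous fun c : Fin n → EuclideanSpace ℂ (Fin M) => Matrix.gram ℂ c := by
    apply continuous_matrix
    intro a b
    simp only [Matrix.gram_apply]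
    fun_prop
  simp only [Matrix.inv_def, Ring.inverse_eq_inv', Matrix.smul_apply, smul_eq_mul]
  exact (hg.matrix_det.measurable.inv).mul ((hg.matrix_adjugate.matrix_elem i j).measurable)

theorem lintegral_gram_inv (M n : ℕ) (hn : n + 1 < M) (σ : Fin (n + 1) → ℝ) (hσ : ∀ j, 0 < σ j)
    (j : Fin (n + 1)) :
    ∫⁻ c, ENNReal.ofReal ((Matrix.gram ℂ c)⁻¹ j j).re ∂(Measure.pi fun j => nuE M (σ j))
      = ENNReal.ofReal (1 / (((M - (n + 1) : ℕ) : ℝ) * σ j)) := by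
  have mp := (measurePreserving_piFinSuccAbove (fun j => nuE M (σ j)) j).symm
  have hm : Measurable fun c : Fin (n + 1) → EuclideanSpace ℂ (Fin M) =>
      ENNReal.ofReal ((Matrix.gram ℂ c)⁻¹ j j).re :=
    (Complex.measurable_re.comp (meas_gram_inv M (n + 1) j j)).ennreal_ofReal
  rw [← mp.lintegral_comp hm]
  refine (lintegral_prod_symm _ (hm.comp mp.measurable).aemeasurable).trans ?_
  have key : ∀ᵐ c ∂(Measure.pi fun k : Fin n => nuE M (σ (j.succAbove k))),
      ∫⁻ x, ENNReal.ofReal ((Matrix.gram ℂ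
        (j.insertNth x c : Fin (n + 1) → EuclideanSpace ℂ (Fin M)))⁻¹ j j).re ∂(nuE M (σ j))
      = ENNReal.ofReal (1 / (((M - (n + 1) : ℕ) : ℝ) * σ j)) := by
    filter_upwards [ae_li M n (by omega) (fun k => σ (j.succAbove k)) (fun k => hσ _)] with c hc
    have hfr : Module.finrank ℂ (Submodule.span ℂ (Set.range c)) = n := by
      simpa using finrank_span_eq_card hc
    have hfr2 := (Submodule.span ℂ (Set.range c)).finrank_add_finrank_orthogonal
    rw [hfr, finrank_euclideanSpace_fin] at hfr2
    rw [← lintegral_inv_proj M (σ j) (hσ j) (Submodule.span ℂ (Set.range c))ᗮ (M - (n + 1))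
      (by omega) (by omega)]
    apply lintegral_congr_ae
    filter_upwards [ae_notMem M (σ j) (hσ j) (Submodule.span ℂ (Set.range c))
      (by omega)] with x hx
    rw [gram_inv_entry M n _ ((li_insertNth j x c).2 ⟨hc, hx⟩) j]
    simp only [Fin.insertNth_apply_succAbove, Fin.insertNth_apply_same, Complex.ofReal_re]
    rw [ENNReal.ofReal_inv_of_pos]
    apply pow_pos
    rw [norm_pos_iff, Submodule.starProjection_orthogonal_val, sub_ne_zero]
    intro h
    exact hx (Submodule.starProjection_eq_self_iff.1 h.symm)
  refine (lintegral_congr_ae key).trans ?_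
  simp

theorem integral_e_mul (M : ℕ) (v : ℝ) (hv : 0 ≤ v) (a b : Fin M) :
    Integrable (fun e : Fin M → ℂ => e a * star (e b)) (Measure.pi fun _ => complexGaussian v) ∧
    ∫ e : Fin M → ℂ, e a * star (e b) ∂(Measure.pi fun _ => complexGaussian v)
      = if a = b then (v : ℂ) else 0 := by
  have mp : ∀ a : Fin M, MeasurePreserving (Function.eval a)
      (Measure.pi fun _ : Fin M => complexGaussian v) (complexGaussian v) :=
    fun a => measurePreserving_eval _ a
  have hL : ∀ a : Fin M, MemLp (fun e : Fin M → ℂ => e a) 2 (Measure.pi fun _ => complexGaussian v) :=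
    fun a => (memLp_complexGaussian v).comp_measurePreserving (mp a)
  have hintg : ∀ a : Fin M, ∫ e : Fin M → ℂ, e a ∂(Measure.pi fun _ => complexGaussian v) = 0 := by
    intro a
    have := integral_map (mp a).aemeasurable (f := fun z : ℂ => z) (by fun_prop)
    rw [(mp a).map_eq, integral_id_complexGaussian] at this
    exact this.symm
  refine ⟨(hL a).integrable_mul (hL b).star, ?_⟩
  split_ifs with hab
  · subst hab
    have h1 : ∀ e : Fin M → ℂ, e a * star (e a) = ((‖e a‖ ^ 2 : ℝ) : ℂ) := by
      intro e
      rw [← Complex.normSq_eq_norm_sq, ← Complex.mul_conj]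
      rfl
    simp_rw [h1]
    rw [integral_complex_ofReal]
    have := integral_map (mp a).aemeasurable (f := fun z : ℂ => ‖z‖ ^ 2) (by fun_prop)
    rw [(mp a).map_eq, integral_normSq_complexGaussian v hv] at this
    exact congrArg _ this.symm
  · have hind : iIndepFun (fun (i : Fin M) (e : Fin M → ℂ) => e i)
        (Measure.pi fun _ => complexGaussian v) :=
      iIndepFun_pi (X := fun _ => id) (fun _ => aemeasurable_id)
    have h2 := (hind.indepFun hab).comp measurable_id (continuous_star (R := ℂ)).measurable
    have h3 := h2.integral_mul_eq_mul_integral (hL a).1 (hL b).star.1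
    have h4 : ∫ e : Fin M → ℂ, e a * star (e b) ∂(Measure.pi fun _ => complexGaussian v)
      = (∫ e : Fin M → ℂ, e a ∂(Measure.pi fun _ => complexGaussian v)) * _ := h3
    rw [h4, hintg a, zero_mul]

theorem lintegral_e (M : ℕ) (v : ℝ) (hv : 0 ≤ v) (w : Fin M → ℂ) :
    ∫⁻ e : Fin M → ℂ, ENNReal.ofReal (‖∑ m, w m * e m‖ ^ 2) ∂(Measure.pi fun _ => complexGaussian v)
      = ENNReal.ofReal (v * ∑ m, ‖w m‖ ^ 2) := by
  have hexp : ∀ e : Fin M → ℂ, ((‖∑ m, w m * e m‖ ^ 2 : ℝ) : ℂ)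
      = ∑ a, ∑ b, (w a * star (w b)) * (e a * star (e b)) := by
    intro e
    rw [← Complex.normSq_eq_norm_sq, ← Complex.mul_conj, map_sum, Finset.sum_mul_sum]
    refine Finset.sum_congr rfl fun a _ => Finset.sum_congr rfl fun b _ => ?_
    rw [map_mul]
    simp only [Complex.star_def]
    ring
  have hI : ∀ a b, Integrable (fun e : Fin M → ℂ => (w a * star (w b)) * (e a * star (e b)))
      (Measure.pi fun _ => complexGaussian v) :=
    fun a b => (integral_e_mul M v hv a b).1.const_mul _
  have hintg : Integrable (fun e : Fin M → ℂ => ((‖∑ m, w m * e m‖ ^ 2 : ℝ) : ℂ))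
      (Measure.pi fun _ => complexGaussian v) := by
    simp_rw [hexp]
    exact integrable_finsetSum _ fun a _ => integrable_finsetSum _ fun b _ => hI a b
  have hval : ∫ e : Fin M → ℂ, ‖∑ m, w m * e m‖ ^ 2 ∂(Measure.pi fun _ => complexGaussian v)
      = v * ∑ m, ‖w m‖ ^ 2 := by
    apply Complex.ofReal_injective
    rw [← integral_complex_ofReal]
    simp_rw [hexp]
    rw [integral_finsetSum _ fun a _ => integrable_finsetSum _ fun b _ => hI a b]
    simp_rw [integral_finsetSum _ fun b _ => hI _ b, integral_const_mul,
      (integral_e_mul M v hv _ _).2]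
    simp only [mul_ite, mul_zero, Finset.sum_ite_eq, Finset.mem_univ, if_true]
    push_cast
    rw [Finset.mul_sum]
    refine Finset.sum_congr rfl fun a _ => ?_
    rw [← Complex.ofReal_pow, ← Complex.normSq_eq_norm_sq, ← Complex.mul_conj]
    simp only [Complex.star_def]
    ring
  rw [← hval, ofReal_integral_eq_lintegral_ofReal]
  · exact (hintg.re :)
  · exact Filter.Eventually.of_forall fun e => by positivity

/-- The matrix with given columns. -/
def matOf {M K : ℕ} (c : Fin K → EuclideanSpace ℂ (Fin M)) : Matrix (Fin M) (Fin K) ℂ :=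
  Matrix.of fun i j => c j i

theorem matOf_gram {M K : ℕ} (c : Fin K → EuclideanSpace ℂ (Fin M)) :
    (matOf c)ᴴ * matOf c = Matrix.gram ℂ c := by
  ext a b
  simp [matOf, Matrix.mul_apply, Matrix.gram_apply, PiLp.inner_apply, mul_comm]

theorem alg1 {M K : ℕ} (G : Matrix (Fin M) (Fin K) ℂ) (h : IsUnit (Gᴴ * G).det)
    (π : Equiv.Perm (Fin K)) (k : Fin K) (e : Fin M → ℂ) :
    (fun i => G i k) ⬝ᵥ
        (G.map star * (Gᵀ * G.map star)⁻¹ * π.permMatrix ℂ * ((Gᴴ * G)⁻¹ * Gᴴ)).mulVec e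
      = ∑ m, ((Gᴴ * G)⁻¹ * Gᴴ) (π k) m * e m := by
  have h0 : Gᵀ * G.map star = (Gᴴ * G)ᵀ := by
    rw [Matrix.transpose_mul]; rfl
  have h1 : IsUnit (Gᵀ * G.map star).det := by rw [h0, Matrix.det_transpose]; exact h
  have h2 : (fun i => G i k) ⬝ᵥ
      (G.map star * (Gᵀ * G.map star)⁻¹ * π.permMatrix ℂ * ((Gᴴ * G)⁻¹ * Gᴴ)).mulVec e
      = (Gᵀ.mulVec ((G.map star * (Gᵀ * G.map star)⁻¹ * π.permMatrix ℂ * ((Gᴴ * G)⁻¹ * Gᴴ)).mulVec e)) k := rfl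
  rw [h2, Matrix.mulVec_mulVec, Matrix.mul_assoc (G.map star * _), ← Matrix.mul_assoc Gᵀ,
    ← Matrix.mul_assoc Gᵀ, Matrix.mul_nonsing_inv _ h1, Matrix.one_mul, ← Matrix.mulVec_mulVec,
    Matrix.permMatrix_mulVec]
  rfl

theorem alg2 {M K : ℕ} (G : Matrix (Fin M) (Fin K) ℂ) (h : IsUnit (Gᴴ * G).det) (j : Fin K) :
    ∑ m, ‖((Gᴴ * G)⁻¹ * Gᴴ) j m‖ ^ 2 = ((Gᴴ * G)⁻¹ j j).re := by
  set W := (Gᴴ * G)⁻¹ * Gᴴ with hW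
  have h1 : W * Wᴴ = (Gᴴ * G)⁻¹ := by
    rw [hW, Matrix.conjTranspose_mul, Matrix.conjTranspose_nonsing_inv, Matrix.conjTranspose_mul,
      Matrix.conjTranspose_conjTranspose, Matrix.mul_assoc, ← Matrix.mul_assoc Gᴴ,
      Matrix.mul_nonsing_inv _ h, Matrix.mul_one]
  rw [← h1, Matrix.mul_apply, Complex.re_sum]
  refine Finset.sum_congr rfl fun m _ => ?_
  rw [Matrix.conjTranspose_apply, ← Complex.normSq_eq_norm_sq, Complex.star_def, Complex.mul_conj,
    Complex.ofReal_re]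

theorem law_columns {Ω : Type*} [MeasurableSpace Ω] (μ : Measure Ω) [IsProbabilityMeasure μ]
    (M K : ℕ) (σsq : Fin K → ℝ)
    (G : Ω → Matrix (Fin M) (Fin K) ℂ) (hG : ∀ i j, Measurable fun ω => G ω i j)
    (hGindep : iIndepFun (fun (p : Fin M × Fin K) ω => G ω p.1 p.2) μ)
    (hGdist : ∀ i j, μ.map (fun ω => G ω i j) = complexGaussian (σsq j)) :
    μ.map (fun ω (j : Fin K) => (WithLp.toLp 2 (fun i => G ω i j) : EuclideanSpace ℂ (Fin M)))
      = Measure.pi fun j => nuE M (σsq j) := by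
  have h1 := hGindep.precomp (g := fun p : Fin K × Fin M => (p.2, p.1))
    (by rintro ⟨a, b⟩ ⟨c, d⟩ h; simp at h; simp [h])
  have h2 := (iIndepFun_iff_map_fun_eq_pi_map
    (fun p : Fin K × Fin M => (hG p.2 p.1).aemeasurable)).1 h1
  simp only [hGdist] at h2
  have h3 := Measure.infinitePi_map_curry (fun (j : Fin K) (_ : Fin M) => complexGaussian (σsq j))
  simp only [Measure.infinitePi_eq_pi] at h3
  have h4 := Measure.pi_map_pi (μ := fun j : Fin K => Measure.pi fun _ : Fin M => complexGaussian (σsq j))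
    (f := fun _ => (WithLp.toLp 2 : (Fin M → ℂ) → EuclideanSpace ℂ (Fin M)))
    (fun _ => by fun_prop)
  change _ = Measure.pi fun j : Fin K => nuE M (σsq j) at h4
  rw [← h4, ← h3, ← h2, Measure.map_map (by fun_prop) ?_, Measure.map_map (by fun_prop) ?_]
  · rfl
  · exact measurable_pi_lambda _ fun p => hG p.2 p.1
  · exact (MeasurableEquiv.curry _ _ _).measurable
theorem stmt_10
    {Ω : Type*} [MeasurableSpace Ω] (μ : Measure Ω) [IsProbabilityMeasure μ]
    (M K : ℕ) (hK : 1 ≤ K) (hMK : K < M)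
    (σsq : Fin K → ℝ) (hσ : ∀ j, 0 < σsq j) (σesq : ℝ) (hσe : 0 ≤ σesq)
    (G : Ω → Matrix (Fin M) (Fin K) ℂ) (hG : Measurable G)
    (hGindep : iIndepFun
      (fun (p : Fin M × Fin K) ω => G ω p.1 p.2) μ)
    (hGdist : ∀ i j, μ.map (fun ω => G ω i j) = complexGaussian (σsq j))
    (e : Ω → Fin M → ℂ) (he : Measurable e)
    (hGe : IndepFun G e μ)
    (heindep : iIndepFun (fun (m : Fin M) ω => e ω m) μ)
    (hedist : ∀ m, μ.map (fun ω => e ω m) = complexGaussian σesq)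
    (π : Equiv.Perm (Fin K)) (Pi : Matrix (Fin K) (Fin K) ℂ)
    (hPi : Pi = π.permMatrix ℂ) (k : Fin K) :
    ∫ ω, ‖(fun i => G ω i k) ⬝ᵥ
        ((G ω).map star * ((G ω)ᵀ * (G ω).map star)⁻¹ * Pi *
          (((G ω)ᴴ * G ω)⁻¹ * (G ω)ᴴ)).mulVec (e ω)‖ ^ 2 ∂μ
      = σesq / (((M : ℝ) - (K : ℝ)) * σsq (π k)) := by
  subst hPi
  obtain ⟨n, rfl⟩ : ∃ n, K = n + 1 := ⟨K - 1, by omega⟩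
  have hGe' : ∀ i j, Measurable fun ω => G ω i j := fun i j =>
    (measurable_pi_apply j).comp ((measurable_pi_apply i).comp hG)
  let col : Matrix (Fin M) (Fin (n + 1)) ℂ → Fin (n + 1) → EuclideanSpace ℂ (Fin M) :=
    fun A j => WithLp.toLp 2 (fun i => A i j)
  have hcol : Measurable col := by
    refine measurable_pi_lambda _ fun j => ?_
    refine (WithLp.measurable_toLp 2 _).comp (measurable_pi_lambda _ fun i => ?_)
    exact (measurable_pi_apply j).comp (measurable_pi_apply i)
  have hmat : ∀ A, matOf (col A) = A := fun A => rfl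
  let P := Measure.pi fun j => nuE M (σsq j)
  let Q := Measure.pi fun _ : Fin M => complexGaussian σesq
  have hlawc : μ.map (fun ω => col (G ω)) = P := law_columns μ M (n + 1) σsq G hGe' hGindep hGdist
  have hlawe : μ.map e = Q := by
    have := (iIndepFun_iff_map_fun_eq_pi_map (f := fun (m : Fin M) ω => e ω m)
      (fun m => ((measurable_pi_apply m).comp he).aemeasurable)).1 heindep
    simp only [hedist] at this
    exact this
  have hcm : Measurable fun ω => col (G ω) := hcol.comp hG
  have hlaw : μ.map (fun ω => (col (G ω), e ω)) = P.prod Q := by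
    have h1 : IndepFun (fun ω => col (G ω)) e μ := hGe.comp hcol measurable_id
    have := (indepFun_iff_map_prod_eq_prod_map_map hcm.aemeasurable he.aemeasurable).1 h1
    rw [this, hlawc, hlawe]
  let w : (Fin (n + 1) → EuclideanSpace ℂ (Fin M)) → Fin M → ℂ := fun c m =>
    (((matOf c)ᴴ * matOf c)⁻¹ * (matOf c)ᴴ) (π k) m
  have hw : ∀ m, Measurable fun c => w c m := by
    intro m
    have : (fun c => w c m) = fun c : Fin (n + 1) → EuclideanSpace ℂ (Fin M) => ∑ b, (Matrix.gram ℂ c)⁻¹ (π k) b * star (c b m) := by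
      funext c
      simp only [w]
      rw [Matrix.mul_apply, matOf_gram]
      rfl
    rw [this]
    refine Finset.measurable_sum _ fun b _ => (meas_gram_inv M (n + 1) _ b).mul ?_
    exact (Continuous.measurable (by fun_prop))
  let H : (Fin (n + 1) → EuclideanSpace ℂ (Fin M)) × (Fin M → ℂ) → ℝ := fun p =>
    ‖∑ m, w p.1 m * p.2 m‖ ^ 2
  have hH : Measurable H := by
    refine (Measurable.norm ?_).pow_const 2
    refine Finset.measurable_sum _ fun m _ => ((hw m).comp measurable_fst).mul ?_
    exact (measurable_pi_apply m).comp measurable_snd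
  have hli : ∀ᵐ c ∂P, IsUnit ((matOf c)ᴴ * matOf c).det := by
    filter_upwards [ae_li M (n + 1) hMK σsq hσ] with c hc
    rw [matOf_gram]
    exact (Matrix.det_gram_ne_zero_iff_linearIndependent.2 hc).isUnit
  have hliω : ∀ᵐ ω ∂μ, IsUnit ((G ω)ᴴ * G ω).det := by
    rw [← hlawc] at hli
    exact ae_of_ae_map hcm.aemeasurable hli
  have hae : ∀ᵐ ω ∂μ, ‖(fun i => G ω i k) ⬝ᵥ
        ((G ω).map star * ((G ω)ᵀ * (G ω).map star)⁻¹ * π.permMatrix ℂ *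
          (((G ω)ᴴ * G ω)⁻¹ * (G ω)ᴴ)).mulVec (e ω)‖ ^ 2 = H (col (G ω), e ω) := by
    filter_upwards [hliω] with ω hω
    rw [alg1 (G ω) hω π k (e ω)]
    rfl
  rw [integral_congr_ae hae]
  rw [← integral_map (φ := fun ω => (col (G ω), e ω)) (hcm.prodMk he).aemeasurable
    hH.aestronglyMeasurable, hlaw,
    integral_eq_lintegral_of_nonneg_ae (Filter.Eventually.of_forall fun p => by positivity)
      hH.aestronglyMeasurable, lintegral_prod _ hH.ennreal_ofReal.aemeasurable]
  have hinner : ∀ᵐ c ∂P, ∫⁻ y, ENNReal.ofReal (H (c, y)) ∂Q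
      = ENNReal.ofReal σesq * ENNReal.ofReal ((Matrix.gram ℂ c)⁻¹ (π k) (π k)).re := by
    filter_upwards [hli] with c hc
    rw [← ENNReal.ofReal_mul hσe, ← matOf_gram, ← alg2 _ hc]
    exact lintegral_e M σesq hσe (w c)
  rw [lintegral_congr_ae hinner, lintegral_const_mul' _ _ ENNReal.ofReal_ne_top,
    lintegral_gram_inv M n hMK σsq hσ (π k), ← ENNReal.ofReal_mul hσe, ENNReal.toReal_ofReal,
    Nat.cast_sub hMK.le]
  · rw [mul_one_div]
  · have := hσ (π k)
    positivity
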